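/- Let D = (V,B) be a 2-(v,4,λ) directed design and let b_1, ..., b_s be distinct blocks of B such that for each i ∈ {1,...,s} (indices taken modulo s) the pair of blocks {b_i, b_{i+1}} is the positive part of some (v,4,2) directed trade of volume 2 contained in D. Then every defining set of D contains at least ⌈s/2⌉ of the blocks b_1, ..., b_s. -/

import Mathlib

open scoped Classical

/-- A block of size `k` on the point set `α`: a list of `k` distinct points. -/
def IsBlock {α : Type*} (k : ℕ) (b : List α) : Prop :=
  b.Nodup ∧ b.length = k

/-- A `t-(v,k,λ)` directed design whose point set is the whole (finite) type `α`
(so `v = Fintype.card α`): every ordered `t`-tuple of distinct points appears,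
as a subsequence, in exactly `lam` blocks of the multiset `B`. -/
def IsDD {α : Type*} (t k lam : ℕ) (B : Multiset (List α)) : Prop :=
  (∀ b ∈ B, IsBlock k b) ∧
    ∀ s : List α, s.Nodup → s.length = t →
      B.countP (fun b => s.Sublist b) = lam

/-- `S` is a defining set of the `t-(v,k,λ)` directed design with block multiset `B`:
`S` is a sub-multiset of `B`, and `B` is the unique block multiset of a
`t-(v,k,λ)DD` on the same point set containing `S`. -/
def IsDefiningSet {α : Type*} (t k lam : ℕ) (B S : Multiset (List α)) : Prop :=
  S ≤ B ∧ ∀ B' : Multiset (List α), IsDD t k lam B' → S ≤ B' → B' = B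

/-- A `(v,k,t)` directed trade `T₁ - T₂` of volume `s` on the point set `α`. -/
def IsTrade {α : Type*} (t k s : ℕ) (T₁ T₂ : Multiset (List α)) : Prop :=
  1 ≤ s ∧ Multiset.card T₁ = s ∧ Multiset.card T₂ = s ∧
    (∀ b ∈ T₁, IsBlock k b) ∧ (∀ b ∈ T₂, IsBlock k b) ∧
    (∀ b, b ∈ T₁ → b ∉ T₂) ∧
    ∀ l : List α, l.Nodup → l.length = t →
      T₁.countP (fun b => l.Sublist b) = T₂.countP (fun b => l.Sublist b)

/-- A multiset of blocks is super-simple if any two blocks (any sub-multiset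
consisting of two blocks) intersect, as point sets, in at most two points. -/
def SuperSimple {α : Type*} (B : Multiset (List α)) : Prop :=
  ∀ b₁ b₂ : List α, ({b₁, b₂} : Multiset (List α)) ≤ B →
    (b₁.toFinset ∩ b₂.toFinset).card ≤ 2

/-- A `2-(v,K,1)` design (pairwise balanced design) on the point type `β`. -/
def IsPBD {β : Type*} (K : Set ℕ) (D : Multiset (Finset β)) : Prop :=
  (∀ b ∈ D, b.card ∈ K) ∧
    ∀ x y : β, x ≠ y → D.countP (fun b => x ∈ b ∧ y ∈ b) = 1

/-- A `{K}`-GDD on the point type `β` with group multiset `Gs` and block multiset `Bs`. -/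
def IsGDD {β : Type*} (K : Set ℕ) (Gs Bs : Multiset (Finset β)) : Prop :=
  (∀ x : β, Gs.countP (fun G => x ∈ G) = 1) ∧
    (∀ b ∈ Bs, b.card ∈ K) ∧
    (∀ b ∈ Bs, ∀ G ∈ Gs, (b ∩ G).card ≤ 1) ∧
    (∀ x y : β, x ≠ y → (∀ G ∈ Gs, ¬(x ∈ G ∧ y ∈ G)) →
      Bs.countP (fun b => x ∈ b ∧ y ∈ b) = 1)

/-- A `4`-DGDD on the point type `β` with group multiset `Gs` and block multiset `B`:
the groups partition the points, no block meets a group twice, and every ordered pair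
of points from distinct groups appears in exactly one block. -/
def IsDGDD {β : Type*} (Gs : Multiset (Finset β)) (B : Multiset (List β)) : Prop :=
  (∀ x : β, Gs.countP (fun G => x ∈ G) = 1) ∧
    (∀ b ∈ B, IsBlock 4 b) ∧
    (∀ b ∈ B, ∀ G ∈ Gs, (b.toFinset ∩ G).card ≤ 1) ∧
    (∀ x y : β, x ≠ y → (∀ G ∈ Gs, ¬(x ∈ G ∧ y ∈ G)) →
      B.countP (fun b => [x, y].Sublist b) = 1)

/-- `S` is a defining set of the `4`-DGDD with groups `Gs` and block multiset `B`. -/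
def IsDGDDDefiningSet {β : Type*} (Gs : Multiset (Finset β)) (B S : Multiset (List β)) : Prop :=
  S ≤ B ∧ ∀ B' : Multiset (List β), IsDGDD Gs B' → S ≤ B' → B' = B

/-- Replacing the positive part of a trade contained in a directed design by its negative part
gives a directed design. -/
theorem IsDD.sub_add_trade {α : Type*} {t k lam s : ℕ} {B T₁ T₂ : Multiset (List α)}
    (hB : IsDD t k lam B) (hT : IsTrade t k s T₁ T₂) (hle : T₁ ≤ B) :
    IsDD t k lam (B - T₁ + T₂) := by
  obtain ⟨-, -, -, -, hblock, -, hcount⟩ := hT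
  refine ⟨fun b hb => ?_, fun l hl hlen => ?_⟩
  · rcases Multiset.mem_add.1 hb with h | h
    · exact hB.1 b (Multiset.mem_of_le (Multiset.sub_le_self B T₁) h)
    · exact hblock b h
  · rw [Multiset.countP_add, ← hcount l hl hlen, ← Multiset.countP_add,
      Multiset.sub_add_cancel hle, hB.2 l hl hlen]

/-- A defining set meets the positive part of every trade contained in the design. -/
theorem IsDefiningSet.exists_mem_trade {α : Type*} {t k lam s : ℕ}
    {B S T₁ T₂ : Multiset (List α)} (hS : IsDefiningSet t k lam B S) (hB : IsDD t k lam B)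
    (hT : IsTrade t k s T₁ T₂) (hle : T₁ ≤ B) : ∃ b ∈ T₁, b ∈ S := by
  by_contra! hdisj
  have hsub : S ≤ B - T₁ := by
    rw [Multiset.le_iff_count]
    intro x
    rw [Multiset.count_sub]
    by_cases hx : x ∈ T₁
    · simp [Multiset.count_eq_zero_of_notMem (hdisj x hx)]
    · simpa [Multiset.count_eq_zero_of_notMem hx] using Multiset.le_iff_count.1 hS.1 x
  have heq := hS.2 _ (hB.sub_add_trade hT hle) (hsub.trans (Multiset.le_add_right _ _))
  have hTT : T₂ = T₁ :=
    add_left_cancel (heq.trans (Multiset.sub_add_cancel hle).symm)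
  obtain ⟨hs, hcard, -, -, -, hne, -⟩ := hT
  obtain ⟨x, hx⟩ := Multiset.card_pos_iff_exists_mem.1 (hcard ▸ hs : 0 < Multiset.card T₁)
  exact hne x hx (hTT ▸ hx)

/-- The cyclic successor on `Fin s` is a bijection. -/
theorem bijective_cyclic_succ {s : ℕ} (hs : 0 < s) :
    Function.Bijective (fun i : Fin s => (⟨(i.1 + 1) % s, Nat.mod_lt _ hs⟩ : Fin s)) := by
  refine Finite.injective_iff_bijective.1 fun i j hij => Fin.ext ?_
  have h : i.1 + 1 ≡ j.1 + 1 [MOD s] := congrArg Fin.val hij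
  exact (Nat.ModEq.add_right_cancel' 1 h).eq_of_lt_of_lt i.2 j.2

/-- A set that, together with its preimage under a bijection, covers a finite type contains at
least half of its elements. -/
theorem card_le_two_mul_card_filter {ι : Type*} [Fintype ι] {f : ι → ι}
    (hf : Function.Bijective f) {p : ι → Prop} [DecidablePred p] (hp : ∀ i, p i ∨ p (f i)) :
    Fintype.card ι ≤ 2 * (Finset.univ.filter p).card := by
  have hcover : (Finset.univ : Finset ι) =
      Finset.univ.filter p ∪ Finset.univ.filter (fun i => p (f i)) := by
    ext i
    simpa using hp i
  have hcard : (Finset.univ.filter (fun i => p (f i))).card = (Finset.univ.filter p).card :=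
    Finset.card_bijective f hf (by simp)
  have hle := Finset.card_union_le (Finset.univ.filter p) (Finset.univ.filter (fun i => p (f i)))
  rw [← hcover, hcard, Finset.card_univ] at hle
  omega

/-- If `b 0, …, b (s-1)` are distinct blocks of a `2-(v,4,λ)DD`
such that each pair of cyclically consecutive blocks is the positive part of a
`(v,4,2)` directed trade of volume 2 contained in the design, then every defining
set contains at least `⌈s/2⌉` of these blocks. -/
theorem stmt2 {α : Type*} [Fintype α] {v lam s : ℕ} (hv : Fintype.card α = v)
    (hs : 0 < s)
    (B : Multiset (List α)) (hB : IsDD 2 4 lam B)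
    (b : Fin s → List α) (hinj : Function.Injective b) (hmem : ∀ i, b i ∈ B)
    (htrade : ∀ i : Fin s, ∃ T₂ : Multiset (List α),
      IsTrade 2 4 2 ({b i, b ⟨(i.1 + 1) % s, Nat.mod_lt _ hs⟩} : Multiset (List α)) T₂ ∧
      ({b i, b ⟨(i.1 + 1) % s, Nat.mod_lt _ hs⟩} : Multiset (List α)) ≤ B)
    (S : Multiset (List α)) (hS : IsDefiningSet 2 4 lam B S) :
    (s + 1) / 2 ≤ (Finset.univ.filter (fun i : Fin s => b i ∈ S)).card := by
  have hp : ∀ i : Fin s, b i ∈ S ∨ b ⟨(i.1 + 1) % s, Nat.mod_lt _ hs⟩ ∈ S := by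
    intro i
    obtain ⟨T₂, hT, hle⟩ := htrade i
    obtain ⟨x, hx, hxS⟩ := hS.exists_mem_trade hB hT hle
    rcases (by simpa using hx : x = b i ∨ x = _) with rfl | rfl
    · exact Or.inl hxS
    · exact Or.inr hxS
  have h : s ≤ 2 * (Finset.univ.filter (fun i : Fin s => b i ∈ S)).card := by
    simpa only [Fintype.card_fin] using
      card_le_two_mul_card_filter (bijective_cyclic_succ hs) (p := fun i => b i ∈ S) hp
  omega
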